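/- Let α > −1 and suppose δ = 1/k + 1/(α+1) < 1/50. Then the least zero x_1 of the generalized Laguerre polynomial L_k^{(α)} satisfies x_1 < V² + 9·V^{4/3} / ((U² − V²)^{1/3} · (2 − 27·δ^{2/3})), where V = √(k+α+1) − √k and U = √(k+α+1) + √k. -/

import Mathlib

/-- The generalized Laguerre polynomial `L_k^{(α)}` as a real function:
`L_k^{(α)}(x) = ∑_{i=0}^{k} ((−1)^i / i!) · (∏_{j=1}^{k−i} (α + i + j))/(k−i)! · x^i`. -/
noncomputable def laguerre (k : ℕ) (α : ℝ) (x : ℝ) : ℝ :=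
  ∑ i ∈ Finset.range (k + 1),
    ((-1 : ℝ) ^ i / (Nat.factorial i)) *
      ((∏ j ∈ Finset.range (k - i), (α + (i : ℝ) + (j : ℝ) + 1)) /
        (Nat.factorial (k - i))) * x ^ i

/-- Coefficients of the Laguerre polynomial. -/
noncomputable def lagCoeff (k : ℕ) (α : ℝ) (i : ℕ) : ℝ :=
  ((-1 : ℝ) ^ i / (Nat.factorial i)) *
      ((∏ j ∈ Finset.range (k - i), (α + (i : ℝ) + (j : ℝ) + 1)) /
        (Nat.factorial (k - i)))

/-- The Laguerre polynomial as a polynomial. -/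
noncomputable def lagPoly (k : ℕ) (α : ℝ) : Polynomial ℝ :=
  ∑ i ∈ Finset.range (k + 1), Polynomial.C (lagCoeff k α i) * Polynomial.X ^ i

theorem lagPoly_eval (k : ℕ) (α x : ℝ) : (lagPoly k α).eval x = laguerre k α x := by
  simp [lagPoly, laguerre, lagCoeff, Polynomial.eval_finsetSum]

theorem lagPoly_coeff (k : ℕ) (α : ℝ) (n : ℕ) :
    (lagPoly k α).coeff n = if n ≤ k then lagCoeff k α n else 0 := by
  simp [lagPoly, Polynomial.coeff_X_pow]

theorem lagCoeff_rec (k : ℕ) (α : ℝ) (i : ℕ) (hi : i < k) :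
    ((i : ℝ) + 1) * (i + (α + 1)) * lagCoeff k α (i + 1) = - ((k : ℝ) - i) * lagCoeff k α i := by
  obtain ⟨m, rfl⟩ := Nat.exists_eq_add_of_lt hi
  have h1 : i + m + 1 - i = m + 1 := by omega
  have h2 : i + m + 1 - (i + 1) = m := by omega
  unfold lagCoeff
  rw [h1, h2, Finset.prod_range_succ']
  have h3 : ∀ j ∈ Finset.range m, (α + (i : ℝ) + ((j + 1 : ℕ) : ℝ) + 1)
      = (α + ((i + 1 : ℕ) : ℝ) + (j : ℝ) + 1) := by
    intro j _; push_cast; ring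
  rw [Finset.prod_congr rfl h3]
  generalize (∏ j ∈ Finset.range m, (α + ((i + 1 : ℕ) : ℝ) + (j : ℝ) + 1)) = P
  have f1 : (Nat.factorial i : ℝ) ≠ 0 := by positivity
  have f2 : (Nat.factorial m : ℝ) ≠ 0 := by positivity
  have f3 : (i : ℝ) + 1 ≠ 0 := by positivity
  have f4 : (m : ℝ) + 1 ≠ 0 := by positivity
  rw [Nat.factorial_succ, Nat.factorial_succ]
  push_cast
  field_simp
  ring

theorem lagPoly_ode (k : ℕ) (α : ℝ) :
    Polynomial.X * (lagPoly k α).derivative.derivative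
      + (Polynomial.C (α + 1) - Polynomial.X) * (lagPoly k α).derivative
      + Polynomial.C (k : ℝ) * lagPoly k α = 0 := by
  have key : ∀ n : ℕ, ((n : ℝ) + 1) * (n + (α + 1)) * (lagPoly k α).coeff (n + 1)
      = - ((k : ℝ) - n) * (lagPoly k α).coeff n := by
    intro n
    rw [lagPoly_coeff, lagPoly_coeff]
    rcases lt_trichotomy n k with h | h | h
    · rw [if_pos (by omega), if_pos (by omega)]
      exact lagCoeff_rec k α n h
    · subst h; simp
    · rw [if_neg (by omega), if_neg (by omega)]; simp
  ext n
  have kn := key n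
  rw [sub_mul]
  clear key
  generalize α + 1 = A at kn ⊢
  cases n with
  | zero =>
    simp [Polynomial.coeff_derivative, Polynomial.coeff_C_mul] at kn ⊢
    linarith
  | succ m =>
    simp [Polynomial.coeff_derivative, Polynomial.coeff_C_mul, Polynomial.coeff_X_mul] at kn ⊢
    linarith

theorem laguerre_ode (k : ℕ) (α x : ℝ) :
    x * (lagPoly k α).derivative.derivative.eval x
      + (α + 1 - x) * (lagPoly k α).derivative.eval x + k * (lagPoly k α).eval x = 0 := by
  have := congrArg (Polynomial.eval x) (lagPoly_ode k α)
  simpa using this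

/-- Potential lower bound. -/
theorem potential_bound (k A v D t : ℝ) (hA : 0 < A) (hv : 0 < v) (hD : 0 < D) (ht : 0 ≤ t)
    (htD : t ≤ D) (h1 : v + (v + D) = 2 * (2 * k + A)) (h2 : v * (v + D) = A ^ 2) :
    (D / (4 * v ^ 2)) * (t - (1 / D + 2 / v) * t ^ 2) ≤
      (4 * k * (v + t) + 2 * A * (v + t) - (v + t) ^ 2 - A ^ 2 + 2 * A) / (4 * (v + t) ^ 2) := by
  have hx : 0 < v + t := by linarith
  have e1 : 4 * k * (v + t) + 2 * A * (v + t) - (v + t) ^ 2 - A ^ 2 + 2 * A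
      = (D - t) * t + 2 * A := by
    rw [← h2]; linear_combination (-(v + t)) * h1
  rw [e1]
  have e2 : (D / (4 * v ^ 2)) * (t - (1 / D + 2 / v) * t ^ 2)
      = (t * (D * v - (v + 2 * D) * t)) / (4 * v ^ 3) := by
    field_simp
  rw [e2, div_le_div_iff₀ (by positivity) (by positivity)]
  have h3 : (D * v - (v + 2 * D) * t) * (v + t) ^ 2 ≤ (D - t) * v ^ 3 := by
    have ha : D * v - (v + 2 * D) * t ≤ (D - t) * (v - 2 * t) := by nlinarith [mul_nonneg ht ht]
    have hb : (v - 2 * t) * (v + t) ^ 2 ≤ v ^ 3 := by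
      nlinarith [mul_nonneg (mul_nonneg ht ht) hv.le, mul_nonneg (mul_nonneg ht ht) ht]
    calc _ ≤ ((D - t) * (v - 2 * t)) * (v + t) ^ 2 := by gcongr
      _ = (D - t) * ((v - 2 * t) * (v + t) ^ 2) := by ring
      _ ≤ _ := mul_le_mul_of_nonneg_left hb (by linarith)
  nlinarith [mul_le_mul_of_nonneg_left h3 ht, mul_pos hA (pow_pos hv 3)]

/-- Picone-type argument: a zero must occur in `[v, v + w]`. -/
theorem exists_zero (k : ℕ) (α v D w : ℝ) (hA : 0 < α + 1) (hv : 0 < v) (hD : 0 < D)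
    (hw : 0 < w) (hwD : w ≤ D) (h1 : v + (v + D) = 2 * (2 * k + (α + 1)))
    (h2 : v * (v + D) = (α + 1) ^ 2)
    (hcond : 20 < (D / (4 * v ^ 2)) * w ^ 3 * (1 - 4 / 7 * ((1 / D + 2 / v) * w))) :
    ∃ y ∈ Set.Icc v (v + w), laguerre k α y = 0 := by
  by_contra! hne
  obtain ⟨C, hC⟩ : ∃ C, C = D / (4 * v ^ 2) := ⟨_, rfl⟩
  obtain ⟨K, hK⟩ : ∃ K, K = 1 / D + 2 / v := ⟨_, rfl⟩
  rw [← hC, ← hK] at hcond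
  set P := lagPoly k α with hP
  have hne' : ∀ t ∈ Set.Icc (0 : ℝ) w, P.eval (v + t) ≠ 0 := by
    intro t ht
    rw [hP, lagPoly_eval]
    exact hne _ ⟨by linarith [ht.1], by linarith [ht.2]⟩
  let f : ℝ → ℝ := fun t =>
    P.derivative.eval (v + t) / P.eval (v + t) + (α + 1) / 2 * (v + t)⁻¹ - 1 / 2
  let φ : ℝ → ℝ := fun t => t * (w - t)
  let G : ℝ → ℝ := fun t => (w ^ 2 * t - 2 * w * t ^ 2 + 4 / 3 * t ^ 3)
    - C * ((w ^ 2 * t ^ 4 / 4 - 2 * w * t ^ 5 / 5 + t ^ 6 / 6)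
      - K * (w ^ 2 * t ^ 5 / 5 - w * t ^ 6 / 3 + t ^ 7 / 7))
  let H : ℝ → ℝ := fun t => φ t ^ 2 * f t - G t
  have hder : ∀ t ∈ Set.Icc (0 : ℝ) w, ∃ d ≤ 0, HasDerivAt H d t := by
    intro t ht
    have hx : 0 < v + t := by linarith [ht.1]
    have hs : HasDerivAt (fun t : ℝ => v + t) 1 t := by
      simpa using (hasDerivAt_id t).const_add v
    have hL : HasDerivAt (fun t : ℝ => P.eval (v + t)) (P.derivative.eval (v + t)) t := 
      HasDerivAt.comp_const_add v t (P.hasDerivAt (v + t))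
    have hL' : HasDerivAt (fun t : ℝ => P.derivative.eval (v + t))
        (P.derivative.derivative.eval (v + t)) t := 
      HasDerivAt.comp_const_add v t (P.derivative.hasDerivAt (v + t))
    have hf : HasDerivAt f _ t :=
      (((hL'.div hL (hne' t ht)).add ((hs.inv hx.ne').const_mul ((α + 1) / 2))).sub_const (1 / 2))
    have hid := hasDerivAt_id' t
    have hφ : HasDerivAt φ (w - 2 * t) t := 
      (hid.mul (hid.const_sub w)).congr_deriv (by ring)
    have hG : HasDerivAt G ((w - 2 * t) ^ 2 - C * (t - K * t ^ 2) * φ t ^ 2) t := by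
      have p := fun (n : ℕ) => hid.pow n
      have := (((hid.const_mul (w ^ 2)).sub ((p 2).const_mul (2 * w))).add
        ((p 3).const_mul (4 / 3))).sub
        ((((((p 4).const_mul (w ^ 2)).div_const 4).sub
          (((p 5).const_mul (2 * w)).div_const 5)).add ((p 6).div_const 6)).sub
        ((((((p 5).const_mul (w ^ 2)).div_const 5).sub
          (((p 6).const_mul w).div_const 3)).add ((p 7).div_const 7)).const_mul K) |>.const_mul C)
      refine this.congr_deriv ?_
      simp only [φ]
      push_cast
      ring
    have hode := laguerre_ode k α (v + t)
    rw [← hP] at hode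
    have hH := ((hφ.pow 2).mul hf).sub hG
    refine ⟨_, ?_, hH⟩
    have hpot := potential_bound k (α + 1) v D t hA hv hD ht.1 (ht.2.trans hwD) h1 h2
    rw [← hC, ← hK] at hpot
    have hn := hne' t ht
    have hric : (P.derivative.derivative.eval (v + t) * P.eval (v + t)
        - P.derivative.eval (v + t) * P.derivative.eval (v + t)) / P.eval (v + t) ^ 2
        + (α + 1) / 2 * (-1 / (v + t) ^ 2)
        = - ((4 * k * (v + t) + 2 * (α + 1) * (v + t) - (v + t) ^ 2 - (α + 1) ^ 2
          + 2 * (α + 1)) / (4 * (v + t) ^ 2)) - f t ^ 2 := by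
      simp only [f]
      generalize P.derivative.derivative.eval (v + t) = L2 at *
      generalize P.derivative.eval (v + t) = L1 at *
      generalize P.eval (v + t) = L0 at *
      generalize v + t = x at *
      have hL2 : L2 = -((α + 1 - x) * L1 + k * L0) / x := by
        field_simp; linarith
      rw [hL2]
      field_simp
      ring
    rw [hric]
    generalize (4 * k * (v + t) + 2 * (α + 1) * (v + t) - (v + t) ^ 2 - (α + 1) ^ 2
          + 2 * (α + 1)) / (4 * (v + t) ^ 2) = Q at *
    simp only [Pi.pow_apply]
    generalize f t = F
    generalize φ t = p
    push_cast
    nlinarith [sq_nonneg ((w - 2 * t) - p * F), mul_le_mul_of_nonneg_right hpot (sq_nonneg p)]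
  have hanti : AntitoneOn H (Set.Icc 0 w) := by
    apply antitoneOn_of_deriv_nonpos (convex_Icc 0 w)
    · intro t ht
      obtain ⟨d, _, h⟩ := hder t ht
      exact h.continuousAt.continuousWithinAt
    · intro t ht
      obtain ⟨d, _, h⟩ := hder t (interior_subset ht)
      exact h.differentiableAt.differentiableWithinAt
    · intro t ht
      obtain ⟨d, hd, h⟩ := hder t (interior_subset ht)
      rw [h.deriv]; exact hd
  have hle := hanti (Set.left_mem_Icc.2 hw.le) (Set.right_mem_Icc.2 hw.le) hw.le
  have e0 : H 0 = 0 := by simp [H, φ, G]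
  have e1 : H w = - (w ^ 3 / 60 * (20 - C * w ^ 3 * (1 - 4 / 7 * (K * w)))) := by
    simp only [H, φ, G]; ring
  rw [e0, e1] at hle
  have : 0 < w ^ 3 / 60 * (C * w ^ 3 * (1 - 4 / 7 * (K * w)) - 20) :=
    mul_pos (by positivity) (by linarith)
  linarith

theorem numeric_bound (e z : ℝ) (he0 : 0 < e) (he1 : e < 737 / 10000)
    (hz : z ≤ 13 / 6 * e * (9 / 2 * (1 + 5 * e))) :
    20 < 729 / 32 * (1 + 5 * e) ^ 3 * (1 - 4 / 7 * z) := by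
  have c1 : 1 - 4 / 7 * z ≥ 1 - 39 / 7 * e * (1 + 5 * e) := by linarith
  have c2 : (1 + 5 * e) ^ 3 ≥ 1 + 15 * e + 75 * e ^ 2 := by
    nlinarith [pow_pos he0 3]
  have c3 : 0 < 1 - 39 / 7 * e * (1 + 5 * e) := by nlinarith
  have c4 : 1 ≤ (1 + 15 * e + 75 * e ^ 2) * (1 - 39 / 7 * e * (1 + 5 * e)) := by
    have s2 : e ^ 2 ≤ 737 / 10000 * e := by nlinarith
    have s3 : e ^ 3 ≤ (737 / 10000) ^ 2 * e := by nlinarith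
    have s4 : e ^ 4 ≤ (737 / 10000) ^ 3 * e := by nlinarith
    nlinarith
  have c5 : (1 + 15 * e + 75 * e ^ 2) * (1 - 39 / 7 * e * (1 + 5 * e))
      ≤ (1 + 5 * e) ^ 3 * (1 - 4 / 7 * z) := by
    gcongr
  linarith

theorem w_le (e W D : ℝ) (he0 : 0 < e) (he1 : e < 737 / 10000) (hW0 : 0 < W) (hD0 : 0 < D)
    (hWD : 6 * W ≤ e * D) : 9 / 2 * W * (1 + 5 * e) ≤ D := by
  nlinarith [mul_pos hW0 he0, mul_pos hD0 he0]

set_option maxHeartbeats 2000000 in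
/-- If `δ = 1/k + 1/(α+1) < 1/50`, then the least zero of `L_k^{(α)}` satisfies
`x₁ < V² + 9 V^{4/3} / ((U² − V²)^{1/3} (2 − 27 δ^{2/3}))`. -/
theorem laguerre_least_zero_lt
    (k : ℕ) (hk : 1 ≤ k) (α : ℝ) (hα : -1 < α)
    (δ : ℝ) (hδ : δ = 1 / (k : ℝ) + 1 / (α + 1)) (hδlt : δ < 1 / 50)
    (V U : ℝ) (hV : V = Real.sqrt ((k : ℝ) + α + 1) - Real.sqrt (k : ℝ))
    (hU : U = Real.sqrt ((k : ℝ) + α + 1) + Real.sqrt (k : ℝ))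
    (x1 : ℝ) (hroot : laguerre k α x1 = 0)
    (hmin : ∀ y : ℝ, laguerre k α y = 0 → x1 ≤ y) :
    x1 < V ^ 2 + 9 * V ^ ((4 : ℝ) / 3) /
      ((U ^ 2 - V ^ 2) ^ ((1 : ℝ) / 3) * (2 - 27 * δ ^ ((2 : ℝ) / 3))) := by
  have hA : 0 < α + 1 := by linarith
  have hk0 : (0 : ℝ) < k := by exact_mod_cast hk
  obtain ⟨p, hp⟩ : ∃ p, p = Real.sqrt (k : ℝ) := ⟨_, rfl⟩
  obtain ⟨q, hq⟩ : ∃ q, q = Real.sqrt ((k : ℝ) + α + 1) := ⟨_, rfl⟩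
  rw [← hp, ← hq] at hV hU
  have hp0 : 0 < p := by rw [hp]; exact Real.sqrt_pos.2 hk0
  have hp2 : p ^ 2 = k := by rw [hp]; exact Real.sq_sqrt hk0.le
  have hq2 : q ^ 2 = k + α + 1 := by rw [hq]; exact Real.sq_sqrt (by linarith)
  have hpq : p < q := by rw [hp, hq]; exact Real.sqrt_lt_sqrt hk0.le (by linarith)
  have hq0 : 0 < q := hp0.trans hpq
  have hAq : α + 1 = (q - p) * (q + p) := by linear_combination hp2 - hq2
  have hV0 : 0 < V := by rw [hV]; linarith
  have hDeq : U ^ 2 - V ^ 2 = 4 * p * q := by rw [hU, hV]; ring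
  have hD0 : 0 < U ^ 2 - V ^ 2 := by rw [hDeq]; positivity
  have hδ0 : 0 < δ := by rw [hδ]; positivity
  obtain ⟨D, hD⟩ : ∃ D, D = U ^ 2 - V ^ 2 := ⟨_, rfl⟩
  obtain ⟨e, he⟩ : ∃ e, e = δ ^ ((2 : ℝ) / 3) := ⟨_, rfl⟩
  obtain ⟨v, hv⟩ : ∃ v, v = V ^ 2 := ⟨_, rfl⟩
  obtain ⟨W, hW⟩ : ∃ W, W = V ^ ((4 : ℝ) / 3) / D ^ ((1 : ℝ) / 3) := ⟨_, rfl⟩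
  have hD0' : 0 < D := hD ▸ hD0
  have hv0 : 0 < v := by rw [hv]; positivity
  have he0 : 0 < e := by rw [he]; positivity
  have hW0 : 0 < W := by rw [hW]; positivity
  have he3 : e ^ 3 = δ ^ 2 := by
    rw [he, ← Real.rpow_natCast, ← Real.rpow_mul hδ0.le, ← Real.rpow_natCast]; norm_num
  have hW3 : W ^ 3 = v ^ 2 / D := by
    rw [hW, div_pow, hv, ← Real.rpow_natCast, ← Real.rpow_mul hV0.le,
      ← Real.rpow_natCast (D ^ ((1 : ℝ) / 3)), ← Real.rpow_mul hD0'.le, ← pow_mul,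
      ← Real.rpow_natCast V (2 * 2)]
    norm_num
  have hDpq : D = 4 * p * q := hD.trans hDeq
  have hvpq : v = (q - p) ^ 2 := by rw [hv, hV]
  have hqp : 0 < q - p := by linarith
  have hδpq : δ = q ^ 2 / (p ^ 2 * ((q - p) * (q + p))) := by
    rw [hδ, ← hp2, hAq]; field_simp; ring
  have hWv : W ≤ e * v := by
    apply le_of_pow_le_pow_left₀ (n := 3) (by norm_num) (by positivity)
    rw [mul_pow, hW3, he3, hδpq, hvpq, hDpq]
    rw [div_pow, div_mul_eq_mul_div, div_le_div_iff₀ (by positivity) (by positivity)]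
    have : p ^ 3 * (q + p) ^ 2 ≤ 4 * q ^ 5 := by
      have a1 : p ^ 3 ≤ q ^ 3 := by gcongr
      have a2 : (q + p) ^ 2 ≤ (q + q) ^ 2 := by gcongr
      calc _ ≤ q ^ 3 * (q + q) ^ 2 := by gcongr
        _ = _ := by ring
    have := mul_le_mul_of_nonneg_left this
      (show 0 ≤ p * (q - p) ^ 6 by positivity)
    linarith
  have hWD : 6 * W ≤ e * D := by
    apply le_of_pow_le_pow_left₀ (n := 3) (by norm_num) (by positivity)
    rw [mul_pow, mul_pow, hW3, he3, hδpq, hvpq, hDpq]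
    rw [div_pow, div_mul_eq_mul_div, mul_div_assoc', div_le_div_iff₀ (by positivity) (by positivity)]
    have h8 : (q - p) ^ 6 * (q + p) ^ 2 ≤ q ^ 8 := by
      have a1 : (q - p) ^ 4 ≤ q ^ 4 := by gcongr; linarith
      have a2 : ((q - p) * (q + p)) ^ 2 ≤ (q ^ 2) ^ 2 := by
        gcongr; nlinarith
      calc _ = (q - p) ^ 4 * ((q - p) * (q + p)) ^ 2 := by ring
        _ ≤ q ^ 4 * (q ^ 2) ^ 2 := by gcongr
        _ = _ := by ring
    have := mul_le_mul_of_nonneg_left h8 (show 0 ≤ p ^ 4 by positivity)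
    have h9 : 0 ≤ p ^ 4 * q ^ 8 := by positivity
    linarith
  have he1 : e < 737 / 10000 := by
    apply lt_of_pow_lt_pow_left₀ 3 (by norm_num)
    rw [he3]
    have : δ ^ 2 < (1 / 50) ^ 2 := by gcongr
    exact this.trans (by norm_num)
  obtain ⟨w, hw⟩ : ∃ w, w = 9 / 2 * W * (1 + 5 * e) := ⟨_, rfl⟩
  have hw0 : 0 < w := by rw [hw]; positivity
  have hwlt : w < 9 * V ^ ((4 : ℝ) / 3) / (D ^ ((1 : ℝ) / 3) * (2 - 27 * e)) := by
    have e2 : 9 * V ^ ((4 : ℝ) / 3) / (D ^ ((1 : ℝ) / 3) * (2 - 27 * e)) = 9 * W / (2 - 27 * e) := by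
      rw [hW, mul_div_assoc', div_div]
    rw [e2, lt_div_iff₀ (by linarith), hw]
    linarith [mul_pos hW0 he0, mul_pos (mul_pos hW0 he0) he0]
  have hKw : (1 / D + 2 / v) * w ≤ 13 / 6 * e * (9 / 2 * (1 + 5 * e)) := by
    have b1 : W / D ≤ e / 6 := by rw [div_le_iff₀ hD0']; linarith
    have b2 : W / v ≤ e := by rw [div_le_iff₀ hv0]; linarith
    have : (1 / D + 2 / v) * w = (W / D + 2 * (W / v)) * (9 / 2 * (1 + 5 * e)) := by
      rw [hw]; ring
    rw [this]
    gcongr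
    linarith
  have hwD : w ≤ D := by
    rw [hw]
    exact w_le e W D he0 he1 hW0 hD0' hWD
  have hcw : (D / (4 * v ^ 2)) * w ^ 3 = 729 / 32 * (1 + 5 * e) ^ 3 := by
    have : w ^ 3 = 729 / 8 * (1 + 5 * e) ^ 3 * (v ^ 2 / D) := by rw [← hW3, hw]; ring
    rw [this]; field_simp; ring
  obtain ⟨y, hy, hy0⟩ := exists_zero k α v D w hA hv0 hD0' hw0 hwD
    (by rw [hvpq, hDpq, hAq, ← hp2]; ring) (by rw [hvpq, hDpq, hAq]; ring) (by
      rw [hcw]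
      exact numeric_bound e _ he0 he1 hKw)
  have := hmin y hy0
  rw [← hD, ← he, ← hv]
  linarith [hy.2]
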